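/- Let Y be a symmetric positive definite g×g real matrix. Set λ = min(λ₁(Y⁻¹), √(π/(3g))), where λ₁(Y⁻¹) is the first minimum of ℤ^g for the norm ‖·‖_{Y⁻¹}. Then ∫_{[0,1]^g} ln f_Y(2,x) dx ≤ -π/(6λ²) - g ln λ - (g/2) ln(6g/(πe)), where f_Y(t,x) = √(det Y) · Σ_{m ∈ ℤ^g} exp(-π t ‖x - m‖_Y²). -/

import Mathlib

open MeasureTheory Real Matrix

noncomputable def coeZ {g : ℕ} (m : Fin g → ℤ) : Fin g → ℝ := fun i => (m i : ℝ)

noncomputable def normY {g : ℕ} (Y : Matrix (Fin g) (Fin g) ℝ) (x : Fin g → ℝ) : ℝ :=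
  Real.sqrt (x ⬝ᵥ Y.mulVec x)

noncomputable def psi {g : ℕ} (Y : Matrix (Fin g) (Fin g) ℝ) (x : Fin g → ℝ) : ℝ :=
  ⨅ m : Fin g → ℤ, normY Y (x - coeZ m)

noncomputable def mu {g : ℕ} (Y : Matrix (Fin g) (Fin g) ℝ) : ℝ :=
  ⨆ x : Fin g → ℝ, psi Y x

noncomputable def lam1 {g : ℕ} (Y : Matrix (Fin g) (Fin g) ℝ) : ℝ :=
  ⨅ m : {m : Fin g → ℤ // m ≠ 0}, normY Y (coeZ (m : Fin g → ℤ))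

noncomputable def fY {g : ℕ} (Y : Matrix (Fin g) (Fin g) ℝ) (t : ℝ) (x : Fin g → ℝ) : ℝ :=
  Real.sqrt Y.det * ∑' m : Fin g → ℤ, Real.exp (-π * t * normY Y (x - coeZ m) ^ 2)

noncomputable def cube (g : ℕ) : Set (Fin g → ℝ) := Set.univ.pi fun _ => Set.Icc (0:ℝ) 1

open scoped ENNReal

theorem lintegral_fin_prod_eq_prod {n : ℕ} (f : Fin n → ℝ → ℝ≥0∞) (hf : ∀ i, Measurable (f i)) :
    ∫⁻ x : Fin n → ℝ, ∏ i, f i (x i) = ∏ i, ∫⁻ x, f i x := by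
  induction n with
  | zero => simp [volume_pi]
  | succ n ih =>
    rw [← ((volume_preserving_piFinSuccAbove (fun _ : Fin (n + 1) => ℝ) 0).symm).lintegral_comp_emb
      (MeasurableEquiv.measurableEmbedding _), Fin.prod_univ_succ,
      ← ih (fun i => f i.succ) (fun i => hf _),
      ← lintegral_prod_mul (hf 0).aemeasurable (Finset.measurable_prod _ fun i _ =>
        (hf i.succ).comp (measurable_pi_apply i)).aemeasurable]
    simp [MeasurableEquiv.piFinSuccAbove, Fin.prod_univ_succ, Measure.volume_eq_prod]

theorem lintegral_cube_tsum_sub_coeZ {g : ℕ} (F : (Fin g → ℝ) → ℝ≥0∞) (hF : Measurable F) :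
    ∫⁻ x in cube g, ∑' m : Fin g → ℤ, F (x - coeZ m) = ∫⁻ x, F x := by
  have hcube : cube g =ᵐ[volume] {x : Fin g → ℝ | ∀ i, ⌊x i⌋ = 0} := by
    have h := (Measure.univ_pi_Ico_ae_eq_Icc (μ := fun _ : Fin g => (volume : Measure ℝ))
      (f := fun _ => 0) (g := fun _ => 1)).symm
    rw [← Set.pi_univ_Icc] at h
    refine h.trans (Filter.EventuallyEq.of_eq ?_)
    refine Set.ext fun x => ?_
    simp [Int.floor_eq_iff]
  have hmeas (m : Fin g → ℤ) : MeasurableSet {x : Fin g → ℝ | ∀ i, ⌊x i⌋ = m i} := by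
    have : {x : Fin g → ℝ | ∀ i, ⌊x i⌋ = m i} = ⋂ i, (fun x : Fin g → ℝ => ⌊x i⌋) ⁻¹' {m i} := by
      ext x; simp
    rw [this]
    exact MeasurableSet.iInter fun i =>
      (Int.measurable_floor.comp (measurable_pi_apply i)) (measurableSet_singleton _)
  have hunion : (⋃ m : Fin g → ℤ, {x : Fin g → ℝ | ∀ i, ⌊x i⌋ = m i}) = Set.univ := by
    ext x; simp only [Set.mem_iUnion, Set.mem_ofPred_eq, Set.mem_univ, iff_true]
    exact ⟨fun i => ⌊x i⌋, fun _ => rfl⟩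
  have hdisj : Pairwise (Function.onFun Disjoint
      fun m : Fin g → ℤ => {x : Fin g → ℝ | ∀ i, ⌊x i⌋ = m i}) := by
    intro m k hmk
    refine Set.disjoint_left.2 fun x hx hx' => hmk (funext fun i => ?_)
    exact (hx i).symm.trans (hx' i)
  rw [setLIntegral_congr hcube, lintegral_tsum fun m => by fun_prop, ← setLIntegral_univ F, ← hunion,
    lintegral_iUnion hmeas hdisj, ← (Equiv.neg (Fin g → ℤ)).tsum_eq]
  refine tsum_congr fun m => ?_
  have h0 := hmeas 0
  simp only [Pi.zero_apply] at h0
  rw [← lintegral_indicator h0, ← lintegral_indicator (hmeas m),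
    ← lintegral_add_right_eq_self (Set.indicator _ F) (coeZ m)]
  refine lintegral_congr fun x => ?_
  have : x - coeZ (-m) = x + coeZ m := by ext i; simp [coeZ]
  simp only [Set.indicator, Set.mem_ofPred_eq, Equiv.neg_apply, this]
  simp only [coeZ, Pi.add_apply, Int.floor_add_intCast, add_eq_right]

theorem Matrix.PosDef.exists_eq_transpose_mul_self {g : ℕ} {Y : Matrix (Fin g) (Fin g) ℝ}
    (hY : Y.PosDef) : ∃ B : Matrix (Fin g) (Fin g) ℝ, IsUnit B.det ∧ Y = Bᵀ * B := by
  open scoped MatrixOrder Matrix.Norms.L2Operator in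
  obtain ⟨B, hB, h⟩ := CStarAlgebra.isStrictlyPositive_iff_eq_star_mul_self.mp hY.isStrictlyPositive
  exact ⟨B, (Matrix.isUnit_iff_isUnit_det B).1 hB, h⟩

theorem normY_sq {g : ℕ} {Y : Matrix (Fin g) (Fin g) ℝ} (hY : Y.PosDef) (x : Fin g → ℝ) :
    normY Y x ^ 2 = x ⬝ᵥ Y.mulVec x :=
  Real.sq_sqrt (by simpa using hY.posSemidef.dotProduct_mulVec_nonneg x)

theorem measurable_normY {g : ℕ} (Y : Matrix (Fin g) (Fin g) ℝ) : Measurable (normY Y) := by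
  have : Continuous (normY Y) := by unfold normY; fun_prop
  exact this.measurable

theorem lintegral_gaussian_two_pi :
    ∫⁻ s : ℝ, ENNReal.ofReal (exp (-2 * π * s ^ 2)) = ENNReal.ofReal (1 / √2) := by
  have hpi : 0 < 2 * π := by positivity
  rw [← ofReal_integral_eq_lintegral_ofReal]
  · have := integral_gaussian (2 * π)
    simp only [neg_mul] at this ⊢
    rw [this]
    congr 1
    rw [one_div, ← Real.sqrt_inv]
    congr 1
    field_simp
  · simpa using integrable_exp_neg_mul_sq hpi
  · exact Filter.Eventually.of_forall fun _ => by positivity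

/-- Rotating a vector onto a coordinate axis. -/
theorem lintegral_gaussian_comp_dotProduct {k : ℕ} (w : Fin (k + 1) → ℝ) (hw : w ≠ 0)
    (G : ℝ → ℝ≥0∞) (hG : Measurable G) :
    ∫⁻ u : Fin (k + 1) → ℝ, ENNReal.ofReal (exp (-2 * π * (u ⬝ᵥ u))) * G (w ⬝ᵥ u) =
      ENNReal.ofReal ((1 / √2) ^ k) *
        ∫⁻ s : ℝ, ENNReal.ofReal (exp (-2 * π * s ^ 2)) * G (√(w ⬝ᵥ w) * s) := by
  set W : EuclideanSpace ℝ (Fin (k + 1)) := WithLp.toLp 2 w with hW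
  have hW0 : W ≠ 0 := by simpa [hW] using hw
  have hnorm : ‖W‖ = √(w ⬝ᵥ w) := by
    simp [EuclideanSpace.norm_eq, hW, dotProduct, sq]
  obtain ⟨b, hb⟩ := Orthonormal.exists_orthonormalBasis_extension_of_card_eq (𝕜 := ℝ)
    (E := EuclideanSpace ℝ (Fin (k + 1))) (ι := Fin (k + 1)) (by simp)
    (v := fun _ => ‖W‖⁻¹ • W) (s := {0}) (by
      constructor
      · intro i
        simp [norm_smul, hW0]
      · intro i j hij
        exact absurd (Subsingleton.elim i j) hij)
  have hb0 : W = ‖W‖ • b 0 := by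
    rw [hb 0 rfl, smul_smul, mul_inv_cancel₀ (norm_ne_zero_iff.2 hW0), one_smul]
  have key : ∀ v : EuclideanSpace ℝ (Fin (k + 1)),
      ENNReal.ofReal (exp (-2 * π * ((WithLp.ofLp v) ⬝ᵥ (WithLp.ofLp v)))) * G (w ⬝ᵥ WithLp.ofLp v)
      = ∏ i, (if i = 0 then fun s => ENNReal.ofReal (exp (-2 * π * s ^ 2)) * G (√(w ⬝ᵥ w) * s)
        else fun s => ENNReal.ofReal (exp (-2 * π * s ^ 2))) (b.repr v i) := by
    intro v
    have h1 : (WithLp.ofLp v) ⬝ᵥ (WithLp.ofLp v) = ∑ i, (b.repr v i) ^ 2 := by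
      have := b.repr.norm_map v
      rw [EuclideanSpace.norm_eq, EuclideanSpace.norm_eq, Real.sqrt_inj (by positivity)
        (by positivity)] at this
      simpa [dotProduct, sq] using this.symm
    have h2 : w ⬝ᵥ WithLp.ofLp v = √(w ⬝ᵥ w) * b.repr v 0 := by
      rw [b.repr_apply_apply, ← hnorm, ← real_inner_smul_left, ← hb0]
      simp [hW, PiLp.inner_apply, dotProduct, mul_comm]
    rw [h1, h2, Finset.mul_sum, Real.exp_sum, ENNReal.ofReal_prod_of_nonneg fun _ _ => by positivity,
      Fin.prod_univ_succ, Fin.prod_univ_succ]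
    simp only [if_true, Fin.succ_ne_zero, if_false]
    ring
  calc _ = ∫⁻ v : EuclideanSpace ℝ (Fin (k + 1)),
        ENNReal.ofReal (exp (-2 * π * ((WithLp.ofLp v) ⬝ᵥ (WithLp.ofLp v)))) *
          G (w ⬝ᵥ WithLp.ofLp v) :=
        ((PiLp.volume_preserving_ofLp (Fin (k + 1))).lintegral_comp_emb
          (MeasurableEquiv.toLp 2 (Fin (k + 1) → ℝ)).symm.measurableEmbedding
          (fun u => ENNReal.ofReal (exp (-2 * π * (u ⬝ᵥ u))) * G (w ⬝ᵥ u))).symm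
    _ = ∫⁻ v : EuclideanSpace ℝ (Fin (k + 1)), ∏ i,
        (if i = 0 then fun s => ENNReal.ofReal (exp (-2 * π * s ^ 2)) * G (√(w ⬝ᵥ w) * s)
          else fun s => ENNReal.ofReal (exp (-2 * π * s ^ 2))) (b.repr v i) := lintegral_congr key
    _ = ∫⁻ u : Fin (k + 1) → ℝ, ∏ i,
        (if i = 0 then fun s => ENNReal.ofReal (exp (-2 * π * s ^ 2)) * G (√(w ⬝ᵥ w) * s)
          else fun s => ENNReal.ofReal (exp (-2 * π * s ^ 2))) (u i) :=
        ((PiLp.volume_preserving_ofLp (Fin (k + 1))).comp b.measurePreserving_repr).lintegral_comp_emb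
          ((MeasurableEquiv.toLp 2 (Fin (k + 1) → ℝ)).symm.measurableEmbedding.comp
            b.measurableEquiv.measurableEmbedding) (fun u : Fin (k + 1) → ℝ => ∏ i,
          (if i = 0 then fun s => ENNReal.ofReal (exp (-2 * π * s ^ 2)) * G (√(w ⬝ᵥ w) * s)
            else fun s => ENNReal.ofReal (exp (-2 * π * s ^ 2))) (u i))
    _ = _ := by
        rw [lintegral_fin_prod_eq_prod, Fin.prod_univ_succ]
        · simp only [if_true, Fin.succ_ne_zero, if_false, lintegral_gaussian_two_pi, Finset.prod_const,
            Finset.card_univ, Fintype.card_fin]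
          rw [mul_comm, ENNReal.ofReal_pow (by positivity)]
        · intro i
          split_ifs <;> fun_prop

theorem lintegral_gaussian_normY {k : ℕ} {Y : Matrix (Fin (k + 1)) (Fin (k + 1)) ℝ} (hY : Y.PosDef)
    (n : Fin (k + 1) → ℝ) (hn : n ≠ 0) (G : ℝ → ℝ≥0∞) (hG : Measurable G) :
    ENNReal.ofReal (√Y.det) *
      ∫⁻ x, ENNReal.ofReal (exp (-π * 2 * normY Y x ^ 2)) * G (n ⬝ᵥ x) =
      ENNReal.ofReal ((1 / √2) ^ k) *
        ∫⁻ s : ℝ, ENNReal.ofReal (exp (-2 * π * s ^ 2)) * G (normY Y⁻¹ n * s) := by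
  obtain ⟨B, hB, hYB⟩ := hY.exists_eq_transpose_mul_self
  have hdet : √Y.det = |B.det| := by
    rw [hYB, det_mul, det_transpose, Real.sqrt_mul_self_eq_abs]
  set w := (B⁻¹)ᵀ *ᵥ n with hw
  have hBw : Bᵀ *ᵥ w = n := by
    rw [hw, mulVec_mulVec, ← transpose_mul, nonsing_inv_mul _ hB, transpose_one, one_mulVec]
  have hw0 : w ≠ 0 := by
    rintro h
    rw [h, mulVec_zero] at hBw
    exact hn hBw.symm
  have hww : normY Y⁻¹ n = √(w ⬝ᵥ w) := by
    rw [normY, hYB, Matrix.mul_inv_rev, ← mulVec_mulVec, ← transpose_nonsing_inv, ← hw]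
    congr 1
    rw [dotProduct_mulVec, ← mulVec_transpose]
  rw [hww, ← lintegral_gaussian_comp_dotProduct w hw0 G hG]
  have hmap := Real.map_matrix_volume_pi_eq_smul_volume_pi hB.ne_zero
  have hmeas : Measurable (Matrix.toLin' B) := (LinearMap.continuous_of_finiteDimensional _).measurable
  have : ∫⁻ x, ENNReal.ofReal (exp (-π * 2 * normY Y x ^ 2)) * G (n ⬝ᵥ x) =
      ∫⁻ u, ENNReal.ofReal (exp (-2 * π * (u ⬝ᵥ u))) * G (w ⬝ᵥ u)
        ∂(Measure.map (Matrix.toLin' B) volume) := by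
    rw [lintegral_map (by unfold dotProduct; fun_prop) hmeas]
    refine lintegral_congr fun x => ?_
    have h1 : normY Y x ^ 2 = B *ᵥ x ⬝ᵥ B *ᵥ x := by
      rw [normY_sq hY, hYB, ← mulVec_mulVec, dotProduct_mulVec, vecMul_transpose]
    have h2 : n ⬝ᵥ x = w ⬝ᵥ B *ᵥ x := by
      rw [dotProduct_mulVec, ← mulVec_transpose, hBw]
    rw [toLin'_apply, h1, h2]
    congr 3
    ring
  rw [this, hmap, lintegral_smul_measure, hdet, smul_eq_mul, ← mul_assoc,
    ← ENNReal.ofReal_mul (abs_nonneg _), abs_inv, mul_inv_cancel₀ (abs_ne_zero.2 hB.ne_zero)]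
  simp

theorem sq_sub_round_le (s : ℝ) : (s - round s) ^ 2 ≤ s ^ 2 - max 0 (2 * |s| - 1) := by
  have h0 : (s - round s) ^ 2 ≤ s ^ 2 := by
    simpa using sq_le_sq.2 (round_le s 0)
  have h1 : (s - round s) ^ 2 ≤ s ^ 2 - (2 * s - 1) := by
    have := sq_le_sq.2 (round_le s 1)
    push_cast at this
    linarith
  have h2 : (s - round s) ^ 2 ≤ s ^ 2 - (-2 * s - 1) := by
    have := sq_le_sq.2 (round_le s (-1))
    push_cast at this
    linarith
  rcases max_cases 0 (2 * |s| - 1) with ⟨h, -⟩ | ⟨h, -⟩ <;> rw [h]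
  · linarith
  · rcases abs_cases s with ⟨h, -⟩ | ⟨h, -⟩ <;> rw [h] <;> linarith

theorem integral_exp_neg_mul_max {c : ℝ} (hc : 0 < c) :
    Integrable (fun s : ℝ => exp (-c * max 0 (2 * |s| - 1))) ∧
      ∫ s : ℝ, exp (-c * max 0 (2 * |s| - 1)) = 1 + 1 / c := by
  have hIoi : IntegrableOn (fun s : ℝ => exp (-c * max 0 (2 * s - 1))) (Set.Ioi (1 / 2)) ∧
      ∫ s in Set.Ioi (1 / 2 : ℝ), exp (-c * max 0 (2 * s - 1)) = 1 / (2 * c) := by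
    have heq : Set.EqOn (fun s : ℝ => exp (-c * max 0 (2 * s - 1)))
        (fun s => exp c * exp (-(2 * c) * s)) (Set.Ioi (1 / 2)) := by
      intro s hs
      have hs' : (1 / 2 : ℝ) < s := hs
      simp only
      rw [max_eq_right (by linarith), ← Real.exp_add]
      ring_nf
    refine ⟨IntegrableOn.congr_fun ?_ heq.symm measurableSet_Ioi, ?_⟩
    · exact (integrableOn_exp_mul_Ioi (by linarith) _).const_mul _
    · rw [setIntegral_congr_fun measurableSet_Ioi heq, integral_const_mul,
        integral_exp_mul_Ioi (by linarith), neg_div_neg_eq, ← mul_div_assoc, ← Real.exp_add]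
      ring_nf
      simp
  have hIoc : ∫ s in Set.Ioc (0 : ℝ) (1 / 2), exp (-c * max 0 (2 * s - 1)) = 1 / 2 := by
    rw [setIntegral_congr_fun (g := fun _ => (1 : ℝ)) measurableSet_Ioc]
    · simp
    · intro s hs
      have hs' : s ≤ 1 / 2 := hs.2
      simp only
      rw [max_eq_left (by linarith)]
      simp
  have hcont : Continuous (fun s : ℝ => exp (-c * max 0 (2 * s - 1))) := by fun_prop
  have hval : ∫ s : ℝ, exp (-c * max 0 (2 * |s| - 1)) = 1 + 1 / c := by
    rw [integral_comp_abs (f := fun s => exp (-c * max 0 (2 * s - 1))),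
      ← Set.Ioc_union_Ioi_eq_Ioi (show (0 : ℝ) ≤ 1 / 2 by norm_num),
      setIntegral_union (Set.Ioc_disjoint_Ioi le_rfl) measurableSet_Ioi hcont.integrableOn_Ioc
        hIoi.1, hIoc, hIoi.2]
    field_simp
  refine ⟨Integrable.of_integral_ne_zero ?_, hval⟩
  rw [hval]
  positivity

theorem lintegral_gaussian_mul_exp_round_le {l c : ℝ} (hl : 0 < l) (hc : 6 ≤ c)
    (hlc : c * l ^ 2 = 2 * π) :
    ∫⁻ s : ℝ, ENNReal.ofReal (exp (-2 * π * s ^ 2)) *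
      ENNReal.ofReal (exp (c * (l * s - round (l * s)) ^ 2)) ≤ ENNReal.ofReal (7 / 6 / l) := by
  obtain ⟨hint, hval⟩ := integral_exp_neg_mul_max (show 0 < c by linarith)
  calc _ ≤ ∫⁻ s : ℝ, ENNReal.ofReal (exp (-c * max 0 (2 * |l * s| - 1))) := by
        refine lintegral_mono fun s => ?_
        rw [← ENNReal.ofReal_mul (by positivity), ← Real.exp_add]
        refine ENNReal.ofReal_le_ofReal (Real.exp_le_exp.2 ?_)
        have h1 := mul_le_mul_of_nonneg_left (sq_sub_round_le (l * s)) (show 0 ≤ c by linarith)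
        have h2 : c * (l * s) ^ 2 = 2 * π * s ^ 2 := by rw [← hlc]; ring
        linarith
    _ = ENNReal.ofReal (∫ s : ℝ, exp (-c * max 0 (2 * |l * s| - 1))) := by
        rw [ofReal_integral_eq_lintegral_ofReal (hint.comp_mul_left' hl.ne')]
        exact Filter.Eventually.of_forall fun _ => by positivity
    _ ≤ _ := by
        refine ENNReal.ofReal_le_ofReal ?_
        rw [Measure.integral_comp_mul_left (fun s => exp (-c * max 0 (2 * |s| - 1))), hval,
          abs_of_pos (inv_pos.2 hl), smul_eq_mul, div_eq_inv_mul _ l]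
        refine mul_le_mul_of_nonneg_left ?_ (inv_pos.2 hl).le
        have : 1 / c ≤ 1 / 6 := one_div_le_one_div_of_le (by norm_num) hc
        linarith

theorem measurable_sq_sub_round : Measurable fun s : ℝ => (s - round s) ^ 2 := by
  have : (round : ℝ → ℤ) = fun s => ⌊s + 1 / 2⌋ := funext round_eq
  have h : Measurable (round : ℝ → ℤ) := by
    rw [this]
    exact Int.measurable_floor.comp (by fun_prop)
  have h' : Measurable fun s : ℝ => ((round s : ℤ) : ℝ) := measurable_from_top.comp h
  fun_prop

theorem sq_sub_round_le_one (s : ℝ) : (s - round s) ^ 2 ≤ 1 := by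
  have := abs_sub_round s
  rw [sq_le_one_iff_abs_le_one]
  linarith

theorem intervalIntegral_sq_sub_round {a : ℤ} (ha : a ≠ 0) (b : ℝ) :
    ∫ s in (0 : ℝ)..1, (a * s + b - round (a * s + b)) ^ 2 = 1 / 12 := by
  have hper : Function.Periodic (fun s : ℝ => (s - round s) ^ 2) 1 := by
    intro s
    simp only
    rw [round_add_one]
    push_cast
    ring
  have hint : ∀ t₁ t₂ : ℝ,
      IntervalIntegrable (fun s : ℝ => (s - round s) ^ 2) volume t₁ t₂ := by
    intro t₁ t₂
    refine (intervalIntegrable_const (c := (1 : ℝ))).mono_fun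
      measurable_sq_sub_round.aestronglyMeasurable ?_
    refine Filter.Eventually.of_forall fun s => ?_
    simpa using sq_sub_round_le_one s
  have hbase : ∫ s in (-(1 / 2) : ℝ)..(-(1 / 2) + 1), (s - round s) ^ 2 = 1 / 12 := by
    have : ∫ s in (-(1 / 2) : ℝ)..(-(1 / 2) + 1), (s - round s) ^ 2 =
        ∫ s in (-(1 / 2) : ℝ)..(-(1 / 2) + 1), s ^ 2 := by
      refine intervalIntegral.integral_congr_Ioo_of_le (by norm_num) fun s hs => ?_
      have hs1 : -(1 / 2) < s := hs.1
      have hs2 : s < -(1 / 2) + 1 := hs.2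
      have : round s = 0 := by
        rw [round_eq, Int.floor_eq_iff]
        constructor <;> push_cast <;> linarith
      simp [this]
    rw [this, integral_pow]
    norm_num
  have ha' : (a : ℝ) ≠ 0 := by exact_mod_cast ha
  have h := hper.intervalIntegral_add_zsmul_eq a b hint
  rw [hper.intervalIntegral_add_eq b (-(1 / 2)), hbase] at h
  rw [intervalIntegral.integral_comp_mul_add (fun s => (s - round s) ^ 2) ha']
  simp only [zsmul_eq_mul, mul_one, smul_eq_mul] at h ⊢
  rw [mul_zero, zero_add, add_comm (a : ℝ) b, h]
  field_simp

theorem volume_cube (g : ℕ) : volume (cube g) = 1 := by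
  simp [cube, Set.pi_univ_Icc, Real.volume_Icc_pi]

theorem integrableOn_cube_sq_sub_round {g : ℕ} (n : Fin g → ℝ) :
    IntegrableOn (fun x => (n ⬝ᵥ x - round (n ⬝ᵥ x)) ^ 2) (cube g) := by
  have : IsFiniteMeasure (volume.restrict (cube g)) := ⟨by simp [volume_cube]⟩
  refine (integrable_const (1 : ℝ)).mono' ?_ (Filter.Eventually.of_forall fun x => ?_)
  · exact (measurable_sq_sub_round.comp (by unfold dotProduct; fun_prop)).aestronglyMeasurable
  · simpa using sq_sub_round_le_one _

theorem integral_cube_sq_sub_round {k : ℕ} (n : Fin (k + 1) → ℤ) (hn : n ≠ 0) :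
    ∫ x in cube (k + 1), (coeZ n ⬝ᵥ x - round (coeZ n ⬝ᵥ x)) ^ 2 = 1 / 12 := by
  obtain ⟨i, hi⟩ : ∃ i, n i ≠ 0 := Function.ne_iff.1 hn
  have hmp := (volume_preserving_piFinSuccAbove (fun _ : Fin (k + 1) => ℝ) i).symm
  have hemb := (MeasurableEquiv.piFinSuccAbove (fun _ : Fin (k + 1) => ℝ) i).symm.measurableEmbedding
  have happ (p : ℝ × (Fin k → ℝ)) :
      (MeasurableEquiv.piFinSuccAbove (fun _ : Fin (k + 1) => ℝ) i).symm p =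
        i.insertNth p.1 p.2 := rfl
  have hpre : (MeasurableEquiv.piFinSuccAbove (fun _ : Fin (k + 1) => ℝ) i).symm ⁻¹' cube (k + 1)
      = Set.Icc (0 : ℝ) 1 ×ˢ cube k := by
    ext p
    rw [Set.mem_preimage, happ, cube, cube, Set.mem_univ_pi, Fin.forall_iff_succAbove i]
    simp only [Fin.insertNth_apply_same, Fin.insertNth_apply_succAbove, Set.mem_prod,
      Set.mem_univ_pi]
  have hdot (p : ℝ × (Fin k → ℝ)) : coeZ n ⬝ᵥ
      (MeasurableEquiv.piFinSuccAbove (fun _ : Fin (k + 1) => ℝ) i).symm p =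
      n i * p.1 + ∑ j, (n (i.succAbove j) : ℝ) * p.2 j := by
    simp [happ, dotProduct, Fin.sum_univ_succAbove _ i, coeZ]
  have hint := integrableOn_cube_sq_sub_round (coeZ n)
  rw [← hmp.integrableOn_comp_preimage hemb, hpre] at hint
  rw [← hmp.setIntegral_preimage_emb hemb, hpre]
  rw [Measure.volume_eq_prod] at hint ⊢
  rw [← setIntegral_prod_swap, setIntegral_prod]
  swap
  · exact hint.swap
  simp only [Prod.swap_prod_mk, hdot]
  have hinner (y : Fin k → ℝ) : ∫ s in Set.Icc (0 : ℝ) 1,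
      (n i * s + ∑ j, (n (i.succAbove j) : ℝ) * y j -
        round (n i * s + ∑ j, (n (i.succAbove j) : ℝ) * y j)) ^ 2 = 1 / 12 := by
    rw [integral_Icc_eq_integral_Ioc, ← intervalIntegral.integral_of_le zero_le_one,
      intervalIntegral_sq_sub_round hi]
  simp [hinner, measureReal_def, volume_cube]

theorem log_add_one_sixth_le {g : ℕ} (hg : 1 ≤ g) {l : ℝ} (hl : 0 < l) (hlg : l ^ 2 ≤ π / (3 * g)) :
    Real.log ((1 / √2) ^ (g - 1) / l) - π / (6 * l ^ 2) + 1 / 6 ≤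
      -π / (6 * l ^ 2) - g * Real.log l - (g / 2 : ℝ) * Real.log (6 * g / (π * Real.exp 1)) := by
  have hpi := Real.pi_pos
  have hg' : (1 : ℝ) ≤ g := by exact_mod_cast hg
  have hg0 : (0 : ℝ) < g := by linarith
  have h1 : Real.log ((1 / √2) ^ (g - 1) / l) = -((g - 1) / 2) * Real.log 2 - Real.log l := by
    rw [Real.log_div (by positivity) hl.ne', Real.log_pow, one_div, Real.log_inv,
      Real.log_sqrt (by norm_num)]
    push_cast [hg]
    ring
  have h2 : Real.log (6 * g / (π * Real.exp 1)) = Real.log 2 + Real.log 3 + Real.log g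
      - Real.log π - 1 := by
    rw [Real.log_div (by positivity) (by positivity), Real.log_mul (by norm_num) (by positivity),
      Real.log_mul (by positivity) (by positivity), Real.log_exp,
      show (6 : ℝ) = 2 * 3 by norm_num, Real.log_mul (by norm_num) (by norm_num)]
    ring
  have h3 : 2 * Real.log l ≤ Real.log π - Real.log 3 - Real.log g := by
    have := Real.log_le_log (by positivity) hlg
    rw [Real.log_pow, Real.log_div (by positivity) (by positivity),
      Real.log_mul (by norm_num) (by positivity)] at this
    push_cast at this
    linarith
  have h4 : Real.log g ≤ g - 1 := Real.log_le_sub_one_of_pos hg0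
  have h5 : Real.log 2 + Real.log 3 - Real.log π ≤ 2 / 3 := by
    rw [← Real.log_mul (by norm_num) (by norm_num), ← Real.log_div (by norm_num) (by positivity),
      Real.log_le_iff_le_exp (by positivity)]
    have hexp : (1.92 : ℝ) ≤ Real.exp (2 / 3) := by
      have := Real.sum_le_exp_of_nonneg (show (0 : ℝ) ≤ 2 / 3 by norm_num) 5
      norm_num [Finset.sum_range_succ, Nat.factorial] at this
      linarith
    refine le_trans ?_ hexp
    rw [div_le_iff₀ hpi]
    have := Real.pi_gt_d2
    linarith
  rw [h1, h2]
  have h6 : ((g : ℝ) - 1) * (2 * Real.log l) ≤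
      (g - 1) * (Real.log π - Real.log 3 - Real.log g) :=
    mul_le_mul_of_nonneg_left h3 (by linarith)
  have h7 : -π / (6 * l ^ 2) = -(π / (6 * l ^ 2)) := neg_div _ _
  rw [h7]
  nlinarith

/-- The function `fY Y 2` with values in `[0, ∞]`. -/
noncomputable def eFY {g : ℕ} (Y : Matrix (Fin g) (Fin g) ℝ) (x : Fin g → ℝ) : ℝ≥0∞ :=
  ENNReal.ofReal (√Y.det) *
    ∑' m : Fin g → ℤ, ENNReal.ofReal (exp (-π * 2 * normY Y (x - coeZ m) ^ 2))

theorem toReal_eFY {g : ℕ} (Y : Matrix (Fin g) (Fin g) ℝ) (x : Fin g → ℝ) :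
    (eFY Y x).toReal = fY Y 2 x := by
  rw [eFY, fY, ENNReal.toReal_mul, ENNReal.toReal_ofReal (by positivity),
    ENNReal.tsum_toReal_eq fun _ => ENNReal.ofReal_ne_top]
  congr 1
  exact tsum_congr fun m => ENNReal.toReal_ofReal (by positivity)

theorem measurable_eFY {g : ℕ} (Y : Matrix (Fin g) (Fin g) ℝ) : Measurable (eFY Y) := by
  have := measurable_normY Y
  unfold eFY
  fun_prop

theorem le_eFY {g : ℕ} (Y : Matrix (Fin g) (Fin g) ℝ) (x : Fin g → ℝ) :
    ENNReal.ofReal (√Y.det * exp (-π * 2 * normY Y x ^ 2)) ≤ eFY Y x := by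
  rw [ENNReal.ofReal_mul (by positivity), eFY]
  gcongr
  have h0 : x - coeZ (0 : Fin g → ℤ) = x := by ext i; simp [coeZ]
  have := ENNReal.le_tsum (f := fun m : Fin g → ℤ =>
    ENNReal.ofReal (exp (-π * 2 * normY Y (x - coeZ m) ^ 2))) 0
  rwa [h0] at this

theorem lintegral_cube_eFY_mul {k : ℕ} {Y : Matrix (Fin (k + 1)) (Fin (k + 1)) ℝ} (hY : Y.PosDef)
    {n : Fin (k + 1) → ℤ} (hn : n ≠ 0) {G : ℝ → ℝ≥0∞} (hG : Measurable G)
    (hper : ∀ (s : ℝ) (z : ℤ), G (s - z) = G s) :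
    ∫⁻ x in cube (k + 1), eFY Y x * G (coeZ n ⬝ᵥ x) =
      ENNReal.ofReal ((1 / √2) ^ k) *
        ∫⁻ s : ℝ, ENNReal.ofReal (exp (-2 * π * s ^ 2)) * G (normY Y⁻¹ (coeZ n) * s) := by
  have hn' : coeZ n ≠ 0 := by
    obtain ⟨i, hi⟩ := Function.ne_iff.1 hn
    exact Function.ne_iff.2 ⟨i, by simpa [coeZ] using hi⟩
  have hmeas := measurable_normY Y
  have hF : Measurable fun x => ENNReal.ofReal (exp (-π * 2 * normY Y x ^ 2)) *
      G (coeZ n ⬝ᵥ x) := by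
    unfold dotProduct
    fun_prop
  rw [← lintegral_gaussian_normY hY _ hn' G hG, ← lintegral_cube_tsum_sub_coeZ _ hF,
    ← lintegral_const_mul _ (by fun_prop)]
  refine lintegral_congr fun x => ?_
  rw [eFY, mul_assoc, ← ENNReal.tsum_mul_right]
  congr 1
  refine tsum_congr fun m => ?_
  congr 1
  have : coeZ n ⬝ᵥ coeZ m = ((n ⬝ᵥ m : ℤ) : ℝ) := by simp [dotProduct, coeZ]
  rw [dotProduct_sub, this, hper]

theorem lintegral_cube_eFY {k : ℕ} {Y : Matrix (Fin (k + 1)) (Fin (k + 1)) ℝ} (hY : Y.PosDef) :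
    ∫⁻ x in cube (k + 1), eFY Y x = ENNReal.ofReal ((1 / √2) ^ (k + 1)) := by
  have := lintegral_cube_eFY_mul hY (n := 1) one_ne_zero (G := fun _ => 1) measurable_const
    fun _ _ => rfl
  simp only [mul_one] at this
  rw [this, lintegral_gaussian_two_pi, ← ENNReal.ofReal_mul (by positivity), pow_succ]

theorem integrableOn_log_fY {k : ℕ} {Y : Matrix (Fin (k + 1)) (Fin (k + 1)) ℝ} (hY : Y.PosDef) :
    (∀ᵐ x ∂volume.restrict (cube (k + 1)), 0 < fY Y 2 x) ∧
      IntegrableOn (fun x => Real.log (fY Y 2 x)) (cube (k + 1)) := by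
  have hfin : ∫⁻ x in cube (k + 1), eFY Y x ≠ ∞ := by
    rw [lintegral_cube_eFY hY]
    exact ENNReal.ofReal_ne_top
  have hlow : ∀ᵐ x ∂volume.restrict (cube (k + 1)),
      √Y.det * exp (-π * 2 * normY Y x ^ 2) ≤ fY Y 2 x := by
    filter_upwards [ae_lt_top (measurable_eFY Y) hfin] with x hx
    rw [← toReal_eFY]
    exact (ENNReal.ofReal_le_iff_le_toReal hx.ne).1 (le_eFY Y x)
  have hdet : 0 < √Y.det := Real.sqrt_pos.2 hY.det_pos
  have hcomp : IsCompact (cube (k + 1)) := isCompact_univ_pi fun _ => isCompact_Icc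
  have hq : IntegrableOn (fun x => Real.log (√Y.det) + -π * 2 * normY Y x ^ 2) (cube (k + 1)) := by
    refine ContinuousOn.integrableOn_compact hcomp (Continuous.continuousOn ?_)
    unfold normY
    fun_prop
  have hf : IntegrableOn (fY Y 2) (cube (k + 1)) := by
    have := integrable_toReal_of_lintegral_ne_top (measurable_eFY Y).aemeasurable hfin
    simpa only [toReal_eFY] using! this
  have hfm : Measurable (fY Y 2) := by
    have := (measurable_eFY Y).ennreal_toReal
    simpa only [toReal_eFY] using! this
  refine ⟨?_, ?_⟩
  · filter_upwards [hlow] with x hx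
    exact lt_of_lt_of_le (by positivity) hx
  · refine (hq.abs.add hf).mono' (hfm.log).aestronglyMeasurable ?_
    filter_upwards [hlow] with x hx
    have hpos : 0 < √Y.det * exp (-π * 2 * normY Y x ^ 2) := by positivity
    have h1 := Real.log_le_log hpos hx
    rw [Real.log_mul hdet.ne' (Real.exp_pos _).ne', Real.log_exp] at h1
    have h2 := Real.log_le_sub_one_of_pos (hpos.trans_le hx)
    have h3 := neg_abs_le (Real.log (√Y.det) + -π * 2 * normY Y x ^ 2)
    have h4 := abs_nonneg (Real.log (√Y.det) + -π * 2 * normY Y x ^ 2)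
    have h5 := hpos.trans_le hx
    simp only [Pi.add_apply, Real.norm_eq_abs]
    exact abs_le.2 ⟨by linarith, by linarith⟩

/-- A weighted form of Jensen's inequality, from `log y ≤ y - 1`. -/
theorem integral_log_fY_le_of_lintegral_le {k : ℕ} {Y : Matrix (Fin (k + 1)) (Fin (k + 1)) ℝ}
    (hY : Y.PosDef) {l : (Fin (k + 1) → ℝ) → ℝ} (hl : Measurable l)
    (hli : IntegrableOn l (cube (k + 1))) {A : ℝ} (hA : 0 ≤ A)
    (h : ∫⁻ x in cube (k + 1), eFY Y x * ENNReal.ofReal (exp (-l x)) ≤ ENNReal.ofReal A) :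
    ∫ x in cube (k + 1), Real.log (fY Y 2 x) ≤ (∫ x in cube (k + 1), l x) + A - 1 := by
  obtain ⟨hpos, hint⟩ := integrableOn_log_fY hY
  have hm : Measurable fun x => eFY Y x * ENNReal.ofReal (exp (-l x)) := by
    have := measurable_eFY Y
    fun_prop
  have hfin := (h.trans_lt ENNReal.ofReal_lt_top).ne
  have htoReal (x : Fin (k + 1) → ℝ) :
      (eFY Y x * ENNReal.ofReal (exp (-l x))).toReal = fY Y 2 x * exp (-l x) := by
    rw [ENNReal.toReal_mul, toReal_eFY, ENNReal.toReal_ofReal (by positivity)]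
  have hfi : IntegrableOn (fun x => fY Y 2 x * exp (-l x)) (cube (k + 1)) := by
    have := integrable_toReal_of_lintegral_ne_top hm.aemeasurable hfin
    simpa only [htoReal] using! this
  have hfv : ∫ x in cube (k + 1), fY Y 2 x * exp (-l x) ≤ A := by
    have := integral_toReal hm.aemeasurable (ae_lt_top hm hfin)
    simp only [htoReal] at this
    rw [this]
    exact ENNReal.toReal_le_of_le_ofReal hA h
  have hone : IntegrableOn (fun _ : Fin (k + 1) → ℝ => (1 : ℝ)) (cube (k + 1)) :=
    integrableOn_const (by simp [volume_cube])
  calc _ ≤ ∫ x in cube (k + 1), (l x + fY Y 2 x * exp (-l x) - 1) := by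
        refine integral_mono_ae hint ((hli.add hfi).sub hone) ?_
        filter_upwards [hpos] with x hx
        have := Real.log_le_sub_one_of_pos (mul_pos hx (Real.exp_pos (-l x)))
        rw [Real.log_mul hx.ne' (Real.exp_pos _).ne', Real.log_exp] at this
        linarith
    _ = (∫ x in cube (k + 1), l x) + (∫ x in cube (k + 1), fY Y 2 x * exp (-l x)) - 1 := by
        rw [integral_sub (by exact hli.add hfi) hone, integral_add hli hfi]
        simp [measureReal_def, volume_cube]
    _ ≤ _ := by linarith

theorem integral_log_fY_le_jensen {k : ℕ} {Y : Matrix (Fin (k + 1)) (Fin (k + 1)) ℝ}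
    (hY : Y.PosDef) :
    ∫ x in cube (k + 1), Real.log (fY Y 2 x) ≤ -((k + 1 : ℕ) / 2) * Real.log 2 := by
  have hlog : Real.log ((1 / √2) ^ (k + 1)) = -((k + 1 : ℕ) / 2) * Real.log 2 := by
    rw [Real.log_pow, one_div, Real.log_inv, Real.log_sqrt (by norm_num)]
    ring
  have := integral_log_fY_le_of_lintegral_le hY (A := 1)
    (l := fun _ => Real.log ((1 / √2) ^ (k + 1))) measurable_const
    (integrableOn_const (by simp [volume_cube])) zero_le_one (by
      rw [lintegral_mul_const _ (measurable_eFY Y), lintegral_cube_eFY hY, Real.exp_neg,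
        Real.exp_log (by positivity), ← ENNReal.ofReal_mul (by positivity),
        mul_inv_cancel₀ (by positivity)])
  rw [← hlog]
  simpa [measureReal_def, volume_cube] using this

theorem normY_inv_pos {g : ℕ} {Y : Matrix (Fin g) (Fin g) ℝ} (hY : Y.PosDef)
    {n : Fin g → ℤ} (hn : n ≠ 0) : 0 < normY Y⁻¹ (coeZ n) := by
  refine Real.sqrt_pos.2 ?_
  have hn' : coeZ n ≠ 0 := by
    obtain ⟨i, hi⟩ := Function.ne_iff.1 hn
    exact Function.ne_iff.2 ⟨i, by simpa [coeZ] using hi⟩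
  simpa using hY.inv.dotProduct_mulVec_pos hn'

theorem integral_log_fY_le_of_normY_le {k : ℕ} {Y : Matrix (Fin (k + 1)) (Fin (k + 1)) ℝ}
    (hY : Y.PosDef) {n : Fin (k + 1) → ℤ} (hn : n ≠ 0)
    (hle : normY Y⁻¹ (coeZ n) ^ 2 ≤ π / (3 * (k + 1 : ℕ))) :
    ∫ x in cube (k + 1), Real.log (fY Y 2 x) ≤
      -π / (6 * normY Y⁻¹ (coeZ n) ^ 2) - (k + 1 : ℕ) * Real.log (normY Y⁻¹ (coeZ n))
      - ((k + 1 : ℕ) / 2 : ℝ) * Real.log (6 * (k + 1 : ℕ) / (π * Real.exp 1)) := by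
  have hpos := normY_inv_pos hY hn
  set r := normY Y⁻¹ (coeZ n) with hr
  have hpi := Real.pi_pos
  set c := 2 * π / r ^ 2 with hc
  have hcr : c * r ^ 2 = 2 * π := by rw [hc]; field_simp
  have hc6 : 6 ≤ c := by
    rw [hc, le_div_iff₀ (by positivity)]
    have : π / (3 * (k + 1 : ℕ)) ≤ π / 3 := by
      refine div_le_div_of_nonneg_left hpi.le (by norm_num) ?_
      push_cast
      nlinarith [(Nat.cast_nonneg k : (0 : ℝ) ≤ k)]
    linarith
  set K := (1 / √2) ^ k / r with hK
  have hKpos : 0 < K := by positivity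
  have hround := measurable_sq_sub_round
  have hdot : Measurable fun x : Fin (k + 1) → ℝ => coeZ n ⬝ᵥ x := by
    unfold dotProduct
    fun_prop
  have hconst : IntegrableOn (fun _ : Fin (k + 1) → ℝ => Real.log K) (cube (k + 1)) :=
    integrableOn_const (by simp [volume_cube])
  have hsq := (integrableOn_cube_sq_sub_round (coeZ n)).const_mul c
  have hper (s : ℝ) (z : ℤ) : ENNReal.ofReal (exp (c * (s - z - round (s - z)) ^ 2)) =
      ENNReal.ofReal (exp (c * (s - round s) ^ 2)) := by
    rw [round_sub_intCast]
    push_cast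
    congr 4
    ring
  have hlint : ∫⁻ x in cube (k + 1), eFY Y x * ENNReal.ofReal
      (exp (-(Real.log K - c * (coeZ n ⬝ᵥ x - round (coeZ n ⬝ᵥ x)) ^ 2))) ≤
        ENNReal.ofReal (7 / 6) := by
    have hG : Measurable fun s : ℝ => ENNReal.ofReal (exp (c * (s - round s) ^ 2)) := by fun_prop
    calc _ = ∫⁻ x in cube (k + 1), ENNReal.ofReal K⁻¹ * (eFY Y x * ENNReal.ofReal
          (exp (c * (coeZ n ⬝ᵥ x - round (coeZ n ⬝ᵥ x)) ^ 2))) := by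
          refine lintegral_congr fun x => ?_
          rw [neg_sub, sub_eq_add_neg, Real.exp_add, Real.exp_neg, Real.exp_log hKpos,
            ENNReal.ofReal_mul (by positivity)]
          ring
      _ = ENNReal.ofReal K⁻¹ * (ENNReal.ofReal ((1 / √2) ^ k) *
            ∫⁻ s : ℝ, ENNReal.ofReal (exp (-2 * π * s ^ 2)) *
              ENNReal.ofReal (exp (c * (r * s - round (r * s)) ^ 2))) := by
          rw [lintegral_const_mul' _ _ ENNReal.ofReal_ne_top, lintegral_cube_eFY_mul hY hn hG hper]
      _ ≤ ENNReal.ofReal K⁻¹ * (ENNReal.ofReal ((1 / √2) ^ k) * ENNReal.ofReal (7 / 6 / r)) := by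
          gcongr
          exact lintegral_gaussian_mul_exp_round_le hpos hc6 hcr
      _ = _ := by
          rw [← ENNReal.ofReal_mul (by positivity), ← ENNReal.ofReal_mul (by positivity)]
          congr 1
          rw [hK]
          field_simp
  have hmain := integral_log_fY_le_of_lintegral_le hY
    (l := fun x => Real.log K - c * (coeZ n ⬝ᵥ x - round (coeZ n ⬝ᵥ x)) ^ 2)
    (measurable_const.sub ((hround.comp hdot).const_mul c)) (hconst.sub hsq) (by norm_num) hlint
  rw [integral_sub hconst hsq, integral_const_mul, integral_cube_sq_sub_round n hn] at hmain
  have hnum := log_add_one_sixth_le (g := k + 1) (by omega) hpos hle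
  refine le_trans (hmain.trans (le_of_eq ?_)) hnum
  simp only [integral_const, measureReal_def, MeasurableSet.univ, Measure.restrict_apply,
    Set.univ_inter, volume_cube, ENNReal.toReal_one, one_smul, Nat.add_sub_cancel]
  rw [hc, hK]
  field_simp
  ring

theorem lam1_inv_pos {k : ℕ} {Y : Matrix (Fin (k + 1)) (Fin (k + 1)) ℝ} (hY : Y.PosDef) :
    0 < lam1 Y⁻¹ := by
  obtain ⟨B, hB, hYB⟩ := hY.inv.exists_eq_transpose_mul_self
  set C := ∑ i, ∑ j, B⁻¹ i j ^ 2 with hC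
  have hC0 : 0 ≤ C := by positivity
  have : Nonempty {m : Fin (k + 1) → ℤ // m ≠ 0} := ⟨1, one_ne_zero⟩
  refine lt_of_lt_of_le (Real.sqrt_pos.2 (show 0 < 1 / (C + 1) by positivity))
    (le_ciInf fun m => Real.sqrt_le_sqrt ?_)
  obtain ⟨i, hi⟩ := Function.ne_iff.1 m.2
  set u := B *ᵥ coeZ m.1 with hu
  have huu : coeZ m.1 ⬝ᵥ Y⁻¹ *ᵥ coeZ m.1 = ∑ j, u j ^ 2 := by
    rw [hYB, ← mulVec_mulVec, dotProduct_mulVec, vecMul_transpose, ← hu]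
    simp [dotProduct, sq]
  have hmi : (m.1 i : ℝ) = ∑ j, B⁻¹ i j * u j := by
    have : B⁻¹ *ᵥ u = coeZ m.1 := by
      rw [hu, mulVec_mulVec, nonsing_inv_mul _ hB, one_mulVec]
    exact (congrFun this i).symm
  have hone : (1 : ℝ) ≤ (m.1 i : ℝ) ^ 2 := by
    have : 1 ≤ m.1 i ^ 2 := Int.one_le_abs (pow_ne_zero 2 hi) |>.trans_eq (abs_sq _)
    exact_mod_cast this
  have hCS := Finset.sum_mul_sq_le_sq_mul_sq Finset.univ (fun j => B⁻¹ i j) u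
  have hrow : ∑ j, B⁻¹ i j ^ 2 ≤ C :=
    Finset.single_le_sum (f := fun i => ∑ j, B⁻¹ i j ^ 2) (fun _ _ => by positivity)
      (Finset.mem_univ i)
  have hu0 : 0 ≤ ∑ j, u j ^ 2 := Finset.sum_nonneg fun _ _ => sq_nonneg _
  have hle : (∑ j, B⁻¹ i j ^ 2) * ∑ j, u j ^ 2 ≤ C * ∑ j, u j ^ 2 :=
    mul_le_mul_of_nonneg_right hrow hu0
  rw [← hmi] at hCS
  rw [huu, div_le_iff₀ (by linarith)]
  linarith

theorem integral_log_fY_two_le {g : ℕ} (hg : 1 ≤ g) (Y : Matrix (Fin g) (Fin g) ℝ)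
    (hsymm : Y.IsSymm) (hY : Y.PosDef) :
    ∫ x in cube g, Real.log (fY Y 2 x) ≤
      -π / (6 * min (lam1 Y⁻¹) (Real.sqrt (π / (3 * g))) ^ 2)
      - g * Real.log (min (lam1 Y⁻¹) (Real.sqrt (π / (3 * g))))
      - (g / 2 : ℝ) * Real.log (6 * g / (π * Real.exp 1)) := by
  obtain ⟨k, rfl⟩ : ∃ k, g = k + 1 := ⟨g - 1, by omega⟩
  have hpi := Real.pi_pos
  have hg0 : (0 : ℝ) < (k + 1 : ℕ) := by positivity
  rcases le_or_gt (Real.sqrt (π / (3 * (k + 1 : ℕ)))) (lam1 Y⁻¹) with h | h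
  · rw [min_eq_right h]
    refine (integral_log_fY_le_jensen hY).trans (le_of_eq ?_)
    rw [Real.sq_sqrt (by positivity), Real.log_sqrt (by positivity),
      Real.log_div (by positivity) (by positivity), Real.log_div (by positivity) (by positivity),
      Real.log_mul (by positivity) (by positivity), Real.log_mul (by positivity) (by positivity),
      Real.log_mul (by positivity) (by positivity), Real.log_exp,
      show (6 : ℝ) = 2 * 3 by norm_num, Real.log_mul (by norm_num) (by norm_num)]
    field_simp
    ring
  · rw [min_eq_left h.le]
    have hlam := lam1_inv_pos hY
    have hne : Nonempty {m : Fin (k + 1) → ℤ // m ≠ 0} := ⟨1, one_ne_zero⟩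
    have hcl : lam1 Y⁻¹ ∈ closure (Set.range
        fun m : {m : Fin (k + 1) → ℤ // m ≠ 0} => normY Y⁻¹ (coeZ (m : Fin (k + 1) → ℤ))) :=
      csInf_mem_closure (Set.range_nonempty _)
        ⟨0, by rintro _ ⟨m, rfl⟩; exact Real.sqrt_nonneg _⟩
    have hcont : ContinuousAt (fun r : ℝ => -π / (6 * r ^ 2) - (k + 1 : ℕ) * Real.log r
        - ((k + 1 : ℕ) / 2 : ℝ) * Real.log (6 * (k + 1 : ℕ) / (π * Real.exp 1))) (lam1 Y⁻¹) := by
      have h0 : 6 * lam1 Y⁻¹ ^ 2 ≠ 0 := by positivity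
      have h1 : lam1 Y⁻¹ ≠ 0 := hlam.ne'
      fun_prop (disch := assumption)
    by_contra! hcon
    have hev := (hcont.eventually (gt_mem_nhds hcon)).and (gt_mem_nhds h)
    obtain ⟨_, ⟨h1, h2⟩, ⟨m, rfl⟩⟩ := mem_closure_iff_nhds.1 hcl _ hev
    refine absurd (integral_log_fY_le_of_normY_le hY m.2 ?_) (not_le.2 h1)
    rw [← Real.sq_sqrt (show 0 ≤ π / (3 * (k + 1 : ℕ)) by positivity)]
    exact pow_le_pow_left₀ (Real.sqrt_nonneg _) h2.le 2
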